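/- Let p be a prime and n = p^s·m with s > 0 and p ∤ m, where m = q^t is a power of a single prime q ≠ p. Then every finite group of order n has a nontrivial normal p-subgroup (O_p(G) ≠ 1) if and only if p^s does not divide Γ(m). -/

import Mathlib

/-- `gam t q = (q^t - 1)(q^(t-1) - 1) ⋯ (q^2 - 1)(q - 1)`, with `gam 0 q = 1`. -/
def gam (t q : ℕ) : ℕ := ∏ i ∈ Finset.range t, (q ^ (i + 1) - 1)

/-- `Gam m = γ(t_1,q_1)⋯γ(t_k,q_k)` where `m = q_1^{t_1}⋯q_k^{t_k}` is the prime
factorization of `m` (so `Gam 1 = 1`). -/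
def Gam (m : ℕ) : ℕ := m.factorization.prod fun q t => gam t q


lemma avg_roots {ι : Type*} [Fintype ι] [Nonempty ι] (ζ : ι → ℂ) (N : ℕ) (hN : 0 < N)
    (hζ : ∀ i, ζ i ^ N = 1) (hIntg : IsIntegral ℤ ((∑ i, ζ i) / (Fintype.card ι : ℂ))) :
    (∑ i, ζ i) = 0 ∨ ∃ c, ∀ i, ζ i = c := by
  classical
  have hn : (Fintype.card ι : ℂ) ≠ 0 := by simp
  have hnR : (0 : ℝ) < (Fintype.card ι : ℝ) := by exact_mod_cast Fintype.card_pos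
  let K := IntermediateField.adjoin ℚ (Set.range ζ)
  have hfin : FiniteDimensional ℚ K := by
    have : Finite (Set.range ζ) := Set.finite_range ζ
    apply IntermediateField.finiteDimensional_adjoin
    rintro x ⟨i, rfl⟩
    exact IsIntegral.of_pow hN (by rw [hζ]; exact isIntegral_one)
  have : NumberField K := ⟨⟩
  let z : ι → K := fun i => ⟨ζ i, IntermediateField.subset_adjoin _ _ ⟨i, rfl⟩⟩
  have hz : ∀ i, z i ^ N = 1 := fun i => by
    apply Subtype.ext; simpa [z] using hζ i
  let x : K := (∑ i, z i) / (Fintype.card ι : K)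
  have hx : (x : ℂ) = (∑ i, ζ i) / (Fintype.card ι : ℂ) := by
    simp [x, z]
  have hxi : IsIntegral ℤ x := by
    have : IsIntegral ℤ (algebraMap K ℂ x) := by
      change IsIntegral ℤ (x : ℂ)
      rw [hx]; exact hIntg
    exact (isIntegral_algebraMap_iff (algebraMap K ℂ).injective).1 this
  by_cases hx0 : x = 0
  · left
    rw [hx0] at hx
    simpa [hn, eq_comm] using hx
  right
  obtain ⟨k, hk, hxk⟩ := NumberField.Embeddings.pow_eq_one_of_norm_le_one K ℂ hx0 hxi (by
    intro φ
    have h1 : φ x = (∑ i, φ (z i)) / (Fintype.card ι : ℂ) := by simp [x]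
    rw [h1, norm_div, Complex.norm_natCast, div_le_one hnR]
    refine (norm_sum_le _ _).trans ?_
    have : ∀ i, ‖φ (z i)‖ = 1 := fun i => by
      apply Complex.norm_eq_one_of_pow_eq_one (n := N) _ hN.ne'
      rw [← map_pow, hz, map_one]
    simp [this])
  set α : ℂ := (∑ i, ζ i) / (Fintype.card ι : ℂ) with hα
  have hαk : α ^ k = 1 := by
    rw [← hx]; exact_mod_cast congrArg (Subtype.val) hxk
  have hα1 : ‖α‖ = 1 := Complex.norm_eq_one_of_pow_eq_one hαk hk.ne'
  have hα0 : α ≠ 0 := by intro h; simp [h] at hα1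
  have hζ1 : ∀ i, ‖ζ i / α‖ = 1 := fun i => by
    rw [norm_div, hα1, Complex.norm_eq_one_of_pow_eq_one (hζ i) hN.ne']; simp
  have hre : ∀ i, (ζ i / α).re ≤ 1 := fun i => (Complex.re_le_norm _).trans (hζ1 i).le
  have hsum : ∑ i, (1 - (ζ i / α).re) = 0 := by
    have h2 : ∑ i, ζ i / α = (Fintype.card ι : ℂ) := by
      rw [← Finset.sum_div, div_eq_iff hα0, hα]; field_simp
    have h3 := congrArg Complex.re h2
    simp only [Complex.re_sum, Complex.natCast_re] at h3
    simp [Finset.sum_sub_distrib, h3]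
  refine ⟨α, fun i => ?_⟩
  have h4 := (Finset.sum_eq_zero_iff_of_nonneg (fun i _ => by linarith [hre i])).1 hsum i
    (Finset.mem_univ i)
  have h5 : (ζ i / α).re = 1 := by linarith
  have h6 : (ζ i / α) = 1 := by
    have h7 := hζ1 i
    have h8 := Complex.sq_norm (ζ i / α)
    rw [h7, Complex.normSq_apply, h5] at h8
    apply Complex.ext
    · simpa using h5
    · have : (ζ i / α).im * (ζ i / α).im = 0 := by linarith
      simpa using this
  rwa [div_eq_one_iff_eq hα0] at h6

open Polynomial in
lemma matrix_scalar {n : ℕ} [NeZero n] (A : Matrix (Fin n) (Fin n) ℂ) (N : ℕ) (hN : 0 < N)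
    (hA : A ^ N = 1) (hIntg : IsIntegral ℤ (A.trace / n)) :
    A.trace = 0 ∨ ∃ c : ℂ, A = algebraMap ℂ _ c := by
  classical
  have hdvd : minpoly ℂ A ∣ X ^ N - 1 := minpoly.dvd _ _ (by simp [hA])
  have hS : ∀ z ∈ A.charpoly.roots, z ^ N = 1 := by
    intro z hz
    have h1 : A.charpoly.IsRoot z := (mem_roots'.1 hz).2
    have h2 : (minpoly ℂ A).IsRoot z := by
      rw [← Matrix.charpoly_toLin'] at h1
      have := (Module.End.hasEigenvalue_iff_isRoot_charpoly _ _).2 h1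
      have := Module.End.isRoot_of_hasEigenvalue this
      rwa [Matrix.minpoly_toLin'] at this
    have := h2.dvd hdvd
    simpa [sub_eq_zero] using this
  have hcard : A.charpoly.roots.card = n := by
    rw [← (IsAlgClosed.splits A.charpoly).natDegree_eq_card_roots, Matrix.charpoly_natDegree_eq_dim]
    simp
  have htr := Matrix.trace_eq_sum_roots_charpoly A
  have hprod : A.charpoly = (A.charpoly.roots.map (fun a => X - C a)).prod := by
    simpa [A.charpoly_monic.leadingCoeff] using (IsAlgClosed.splits A.charpoly).eq_prod_roots
  generalize hSS : A.charpoly.roots = S at *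
  have hc : Fintype.card S.ToType = n := by rw [Multiset.card_coe, hcard]
  have hne : Nonempty S.ToType := by
    rw [← Fintype.card_pos_iff, hc]; exact Nat.pos_of_ne_zero (NeZero.ne n)
  have hsum : ∑ i : S.ToType, (i.1 : ℂ) = S.sum := by
    conv_rhs => rw [← Multiset.map_univ_coe S]
    rfl
  have := avg_roots (fun i : S.ToType => (i.1 : ℂ)) N hN (fun i => hS _ (Multiset.coe_mem))
    (by rw [hsum, ← htr, hc]; exact hIntg)
  rw [hsum, ← htr] at this
  refine this.imp id ?_
  rintro ⟨c, hcc⟩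
  refine ⟨c, ?_⟩
  have hrep : S = Multiset.replicate n c := by
    rw [Multiset.eq_replicate]
    refine ⟨hcard, fun b hb => ?_⟩
    rw [← Multiset.map_univ_coe S] at hb
    obtain ⟨i, -, rfl⟩ := Multiset.mem_map.1 hb
    exact hcc i
  have hch : A.charpoly = (X - C c) ^ n := by
    rw [hprod, hrep]; simp
  have hsq : Squarefree (minpoly ℂ A) := by
    refine Squarefree.squarefree_of_dvd hdvd ?_
    apply Separable.squarefree
    have := separable_X_pow_sub_C (F := ℂ) (n := N) 1 (by exact_mod_cast hN.ne') one_ne_zero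
    simpa using this
  have h1 : minpoly ℂ A ∣ (X - C c) ^ n := by
    rw [← hch]; exact Matrix.minpoly_dvd_charpoly A
  have h2 := (hsq.dvd_pow_iff_dvd (NeZero.ne n)).1 h1
  have h3 := (minpoly.dvd_iff).1 h2
  simpa [sub_eq_zero] using h3
open scoped Classical in
lemma trace_pi_matrix {r : ℕ} {d : Fin r → ℕ} (a : Π i, Matrix (Fin (d i)) (Fin (d i)) ℂ) :
    LinearMap.trace ℂ _ (LinearMap.mulLeft ℂ a) = ∑ i, (d i : ℂ) * (a i).trace := by
  let b := Pi.basis (fun i => Matrix.stdBasis ℂ (Fin (d i)) (Fin (d i)))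
  rw [LinearMap.trace_eq_matrix_trace _ b, Matrix.trace, Fintype.sum_sigma]
  refine Finset.sum_congr rfl fun i _ => ?_
  have key : ∀ j k : Fin (d i), (LinearMap.toMatrix b b (LinearMap.mulLeft ℂ a)).diag ⟨i, (j, k)⟩ = a i j j := by
    intro j k
    rw [Matrix.diag_apply, LinearMap.toMatrix_apply]
    simp only [b, Pi.basis_repr, Pi.basis_apply, LinearMap.mulLeft_apply, Pi.mul_apply, Pi.single_eq_same, Matrix.stdBasis_eq_single]
    change ((Matrix.stdBasis ℂ (Fin (d i)) (Fin (d i))).repr _) (j,k) = _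
    simp [Matrix.stdBasis, Module.Basis.map, Matrix.ofLinearEquiv]
  rw [Fintype.sum_prod_type]
  simp_rw [key]
  simp [Matrix.trace, Finset.mul_sum]
lemma trace_monoidAlgebra {G : Type} [Group G] [Fintype G] (a : MonoidAlgebra ℂ G) :
    LinearMap.trace ℂ _ (LinearMap.mulLeft ℂ a) = (Fintype.card G : ℂ) * a.coeff 1 := by
  classical
  rw [LinearMap.trace_eq_matrix_trace _ (MonoidAlgebra.basis G ℂ), Matrix.trace]
  have : ∀ g : G, (LinearMap.toMatrix (MonoidAlgebra.basis G ℂ) (MonoidAlgebra.basis G ℂ) (LinearMap.mulLeft ℂ a)).diag g = a.coeff 1 := by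
    intro g
    rw [Matrix.diag_apply, LinearMap.toMatrix_apply]
    have := MonoidAlgebra.coeff_mul_single_apply a 1 g g
    simp at this
    simp [MonoidAlgebra.basis]
  simp_rw [this]
  simp

open Polynomial in
lemma trace_isIntegral {n : ℕ} (A : Matrix (Fin n) (Fin n) ℂ) (N : ℕ) (hN : 0 < N)
    (hA : A ^ N = 1) : IsIntegral ℤ A.trace := by
  classical
  have hdvd : minpoly ℂ A ∣ X ^ N - 1 := minpoly.dvd _ _ (by simp [hA])
  rw [Matrix.trace_eq_sum_roots_charpoly A]
  apply IsIntegral.multiset_sum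
  intro z hz
  have h1 : A.charpoly.IsRoot z := (mem_roots'.1 hz).2
  have h2 : (minpoly ℂ A).IsRoot z := by
    rw [← Matrix.charpoly_toLin'] at h1
    have := (Module.End.hasEigenvalue_iff_isRoot_charpoly _ _).2 h1
    have := Module.End.isRoot_of_hasEigenvalue this
    rwa [Matrix.minpoly_toLin'] at this
  have := h2.dvd hdvd
  have h3 : z ^ N = 1 := by simpa [sub_eq_zero] using this
  exact IsIntegral.of_pow hN (by rw [h3]; exact isIntegral_one)

section irr
variable {G : Type} [Group G] [Fintype G] {n : ℕ}

lemma central_scalar (φ : MonoidAlgebra ℂ G →ₐ[ℂ] Matrix (Fin n) (Fin n) ℂ)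
    (hφ : Function.Surjective φ) (a : MonoidAlgebra ℂ G)
    (ha : ∀ h : G, MonoidAlgebra.single h 1 * a = a * MonoidAlgebra.single h 1) :
    ∃ c : ℂ, φ a = algebraMap ℂ _ c := by
  have h1 : ∀ b : MonoidAlgebra ℂ G, b * a = a * b := by
    intro b
    induction b using MonoidAlgebra.induction_on with
    | of g => exact ha g
    | add x y hx hy => rw [add_mul, mul_add, hx, hy]
    | smul r x hx => rw [smul_mul_assoc, hx, mul_smul_comm]
  have h2 : φ a ∈ Subalgebra.center ℂ (Matrix (Fin n) (Fin n) ℂ) := by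
    rw [Subalgebra.mem_center_iff]
    intro b
    obtain ⟨b, rfl⟩ := hφ b
    rw [← map_mul, h1, map_mul]
  rw [Algebra.IsCentral.center_eq_bot, Algebra.mem_bot] at h2
  obtain ⟨c, hc⟩ := h2
  exact ⟨c, hc.symm⟩

lemma dim_one [NeZero n] (φ : MonoidAlgebra ℂ G →ₐ[ℂ] Matrix (Fin n) (Fin n) ℂ)
    (hφ : Function.Surjective φ)
    (ha : ∀ h : G, ∃ c : ℂ, φ (MonoidAlgebra.single h 1) = algebraMap ℂ _ c) : n = 1 := by
  have h1 : ∀ b : MonoidAlgebra ℂ G, ∃ c : ℂ, φ b = algebraMap ℂ _ c := by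
    intro b
    induction b using MonoidAlgebra.induction_on with
    | of g => exact ha g
    | add x y hx hy =>
      obtain ⟨c, hc⟩ := hx
      obtain ⟨d, hd⟩ := hy
      exact ⟨c + d, by rw [map_add, map_add, hc, hd]⟩
    | smul r x hx =>
      obtain ⟨c, hc⟩ := hx
      exact ⟨r * c, by rw [map_smul, hc, map_mul, Algebra.smul_def]⟩
  by_contra hn
  have h0 : 0 < n := Nat.pos_of_ne_zero (NeZero.ne n)
  have h2 : 1 < n := by omega
  obtain ⟨b, hb⟩ := hφ (Matrix.single ⟨0, h0⟩ ⟨1, h2⟩ 1)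
  obtain ⟨c, hc⟩ := h1 b
  rw [hb] at hc
  have := congrFun (congrFun hc ⟨0, h0⟩) ⟨1, h2⟩
  simp [Matrix.algebraMap_matrix_apply] at this

/-- The class sum. -/
noncomputable def classSum (R : Type) [CommRing R] (g : G) : MonoidAlgebra R G :=
  open scoped Classical in ∑ x ∈ (conjugatesOf g).toFinset, MonoidAlgebra.single x 1

lemma classSum_comm (R : Type) [CommRing R] (g h : G) :
    MonoidAlgebra.single h 1 * classSum R g = classSum R g * MonoidAlgebra.single h 1 := by
  classical
  unfold classSum
  rw [Finset.mul_sum, Finset.sum_mul]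
  refine Finset.sum_nbij' (fun x => h * x * h⁻¹) (fun x => h⁻¹ * x * h) ?_ ?_ ?_ ?_ ?_
  · intro x hx
    rw [Set.mem_toFinset] at hx ⊢
    change IsConj _ _ at hx
    change IsConj _ _
    exact hx.trans (isConj_iff.2 ⟨h, rfl⟩)
  · intro x hx
    rw [Set.mem_toFinset] at hx ⊢
    change IsConj _ _ at hx
    change IsConj _ _
    exact hx.trans (isConj_iff.2 ⟨h⁻¹, by simp⟩)
  · intro x _; group
  · intro x _; group
  · intro x _; simp [MonoidAlgebra.single_mul_single]

lemma classSum_isIntegral (g : G) : IsIntegral ℤ (classSum ℂ g) := by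
  classical
  have h1 : IsIntegral ℤ (classSum ℤ g) := Algebra.IsIntegral.isIntegral _
  have h2 : MonoidAlgebra.mapRingHom G (Int.castRingHom ℂ) (classSum ℤ g) = classSum ℂ g := by
    simp [classSum]
  rw [← h2]
  exact h1.map (MonoidAlgebra.mapRingHom G (Int.castRingHom ℂ)).toIntAlgHom

lemma trace_div_integral [NeZero n] (φ : MonoidAlgebra ℂ G →ₐ[ℂ] Matrix (Fin n) (Fin n) ℂ)
    (hφ : Function.Surjective φ) (g : G) (hco : (Nat.card (conjugatesOf g)).Coprime n) :
    IsIntegral ℤ ((φ (MonoidAlgebra.single g 1)).trace / n) := by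
  classical
  have hn : (n : ℂ) ≠ 0 := by exact_mod_cast NeZero.ne n
  obtain ⟨w, hw⟩ := central_scalar φ hφ (classSum ℂ g) (classSum_comm ℂ g)
  have hwi : IsIntegral ℤ w := by
    have h1 : IsIntegral ℤ (φ (classSum ℂ g)) :=
      (classSum_isIntegral g).map (φ.restrictScalars ℤ)
    rw [hw] at h1
    exact (isIntegral_algebraMap_iff
      (FaithfulSMul.algebraMap_injective ℂ (Matrix (Fin n) (Fin n) ℂ))).1 h1
  have hg : (φ (MonoidAlgebra.single g 1)) ^ (Fintype.card G) = 1 := by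
    rw [← map_pow, MonoidAlgebra.single_pow, pow_card_eq_one, one_pow, ← MonoidAlgebra.one_def,
      map_one]
  have hti := trace_isIntegral _ _ Fintype.card_pos hg
  have htr : (Nat.card (conjugatesOf g) : ℂ) * (φ (MonoidAlgebra.single g 1)).trace = n * w := by
    have h1 := congrArg Matrix.trace hw
    have h2 : ∀ x ∈ (conjugatesOf g).toFinset, (φ (MonoidAlgebra.single x 1)).trace =
        (φ (MonoidAlgebra.single g 1)).trace := by
      intro x hx
      rw [Set.mem_toFinset] at hx
      change IsConj _ _ at hx
      obtain ⟨c, rfl⟩ := isConj_iff.1 hx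
      have : (MonoidAlgebra.single (c * g * c⁻¹) 1 : MonoidAlgebra ℂ G) =
        MonoidAlgebra.single c 1 * MonoidAlgebra.single g 1 * MonoidAlgebra.single c⁻¹ 1 := by
        simp [MonoidAlgebra.single_mul_single]
      rw [this, map_mul, map_mul, Matrix.trace_mul_comm, ← mul_assoc, ← map_mul]
      simp [MonoidAlgebra.single_mul_single, ← MonoidAlgebra.one_def]
    rw [classSum, map_sum, Matrix.trace_sum, Finset.sum_congr rfl h2] at h1
    rw [Nat.card_eq_fintype_card, ← Set.toFinset_card]
    simpa [Matrix.trace, Matrix.algebraMap_matrix_apply] using h1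
  have hb := Nat.gcd_eq_gcd_ab (Nat.card (conjugatesOf g)) n
  rw [hco] at hb
  generalize Nat.gcdA _ _ = u at hb
  generalize Nat.gcdB _ _ = v at hb
  have hb' : (1 : ℂ) = (Nat.card (conjugatesOf g) : ℂ) * u + n * v := by exact_mod_cast hb
  have : (φ (MonoidAlgebra.single g 1)).trace / n = u * w + v * (φ (MonoidAlgebra.single g 1)).trace := by
    rw [div_eq_iff hn]
    linear_combination (φ (MonoidAlgebra.single g 1)).trace * hb' + u * htr
  rw [this]
  have hu : ∀ u : ℤ, IsIntegral ℤ (u : ℂ) := fun u => isIntegral_algebraMap (R := ℤ) (A := ℂ)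
  exact ((hu u).mul hwi).add ((hu v).mul hti)

lemma irr_cases [NeZero n] [IsSimpleGroup G] (hnc : ¬ ∀ a b : G, a * b = b * a)
    (φ : MonoidAlgebra ℂ G →ₐ[ℂ] Matrix (Fin n) (Fin n) ℂ)
    (hφ : Function.Surjective φ) (g : G) (hg1 : g ≠ 1) {p k : ℕ} (hp : p.Prime)
    (hcard : Nat.card (conjugatesOf g) = p ^ k) :
    p ∣ n ∨ (φ (MonoidAlgebra.single g 1)).trace = 0 ∨
      ∀ h : G, φ (MonoidAlgebra.single h 1) = 1 := by
  by_cases hpn : p ∣ n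
  · exact Or.inl hpn
  right
  have hg : (φ (MonoidAlgebra.single g 1)) ^ (Fintype.card G) = 1 := by
    rw [← map_pow, MonoidAlgebra.single_pow, pow_card_eq_one, one_pow, ← MonoidAlgebra.one_def,
      map_one]
  have hco : (Nat.card (conjugatesOf g)).Coprime n := by
    rw [hcard]; exact Nat.Coprime.pow_left _ ((Nat.Prime.coprime_iff_not_dvd hp).2 hpn)
  refine (matrix_scalar _ _ Fintype.card_pos hg (trace_div_integral φ hφ g hco)).imp id ?_
  intro hsc
  let ρ : G →* Matrix (Fin n) (Fin n) ℂ := (φ : MonoidAlgebra ℂ G →* _).comp (MonoidAlgebra.of ℂ G)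
  have hρ : ∀ h, φ (MonoidAlgebra.single h 1) = ρ h := fun h => rfl
  have hinv : ∀ h, ρ h * ρ h⁻¹ = 1 := fun h => by rw [← map_mul, mul_inv_cancel, map_one]
  have hinv' : ∀ h, ρ h⁻¹ * ρ h = 1 := fun h => by rw [← map_mul, inv_mul_cancel, map_one]
  simp only [hρ] at *
  -- the subgroup of elements acting as scalars
  let Z : Subgroup G :=
    { carrier := {h | ∀ M, ρ h * M = M * ρ h}
      one_mem' := by intro M; simp
      mul_mem' := by
        intro a b ha hb M
        rw [map_mul, mul_assoc, hb M, ← mul_assoc, ha M, mul_assoc]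
      inv_mem' := by
        intro a ha M
        calc ρ a⁻¹ * M = ρ a⁻¹ * (M * ρ a) * ρ a⁻¹ := by
              rw [mul_assoc, mul_assoc, hinv, mul_one]
          _ = ρ a⁻¹ * (ρ a * M) * ρ a⁻¹ := by rw [ha M]
          _ = M * ρ a⁻¹ := by rw [← mul_assoc, hinv', one_mul] }
  have hZn : Z.Normal := by
    constructor
    intro a ha b M
    rw [map_mul, map_mul, ← ha (ρ b)]
    rw [mul_assoc (ρ a), hinv, mul_one]
    exact ha M
  have hgZ : g ∈ Z := by
    intro M
    obtain ⟨c, hc⟩ := hsc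
    rw [hc]; exact Algebra.commutes c M
  have hZtop : Z = ⊤ := by
    refine (hZn.eq_bot_or_eq_top).resolve_left ?_
    intro hbot
    rw [hbot, Subgroup.mem_bot] at hgZ
    exact hg1 hgZ
  have hcomm : ∀ a b : G, ρ a * ρ b = ρ b * ρ a := fun a b => by
    have : a ∈ Z := by rw [hZtop]; trivial
    exact this (ρ b)
  have hker : ρ.ker = ⊤ := by
    refine ((inferInstance : ρ.ker.Normal).eq_bot_or_eq_top).resolve_left ?_
    intro hbot
    have hinj := (MonoidHom.ker_eq_bot_iff ρ).1 hbot
    exact hnc fun a b => hinj (by rw [map_mul, map_mul, hcomm])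
  intro h
  have : h ∈ ρ.ker := by rw [hker]; trivial
  exact this

end irr

lemma not_simple_of_class_card {G : Type} [Group G] [Fintype G] [IsSimpleGroup G]
    (hnc : ¬ ∀ a b : G, a * b = b * a) (g : G) (hg1 : g ≠ 1) {p k : ℕ} (hp : p.Prime)
    (hcard : Nat.card (conjugatesOf g) = p ^ k) : False := by
  classical
  obtain ⟨r, d, hd, ⟨e⟩⟩ :=
    IsSemisimpleRing.exists_algEquiv_pi_matrix_of_isAlgClosed ℂ (MonoidAlgebra ℂ G)
  let φ : ∀ i, MonoidAlgebra ℂ G →ₐ[ℂ] Matrix (Fin (d i)) (Fin (d i)) ℂ := fun i =>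
    (Pi.evalAlgHom ℂ (fun i => Matrix (Fin (d i)) (Fin (d i)) ℂ) i).comp e.toAlgHom
  have hφe : ∀ i a, φ i a = e a i := fun i a => rfl
  have hφ : ∀ i, Function.Surjective (φ i) := by
    intro i M
    obtain ⟨a, ha⟩ := e.surjective (Pi.single i M)
    exact ⟨a, by rw [hφe, ha, Pi.single_eq_same]⟩
  have htr : ∀ a : MonoidAlgebra ℂ G,
      (Fintype.card G : ℂ) * a.coeff 1 = ∑ i, (d i : ℂ) * (φ i a).trace := by
    intro a
    rw [← trace_monoidAlgebra, ← LinearMap.trace_conj' _ e.toLinearEquiv]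
    simp only [hφe]
    rw [← trace_pi_matrix]
    congr 1
    refine LinearMap.ext fun x => ?_
    simp [LinearEquiv.conj_apply]
  have hG0 : (Fintype.card G : ℂ) ≠ 0 := by simp
  let T : Finset (Fin r) := Finset.univ.filter fun i => ∀ h : G, φ i (MonoidAlgebra.single h 1) = 1
  have hdT : ∀ i ∈ T, d i = 1 := by
    intro i hi
    have := (Finset.mem_filter.1 hi).2
    exact dim_one (φ i) (hφ i) (fun h => ⟨1, by rw [this, map_one]⟩)
  have hTcard : T.card = 1 := by
    let a : MonoidAlgebra ℂ G := ∑ h : G, MonoidAlgebra.single h 1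
    have ha1 : a.coeff 1 = 1 := by simp [a, MonoidAlgebra.coeff_sum, Finsupp.single_apply]
    have hal : ∀ h : G, MonoidAlgebra.single h 1 * a = a := by
      intro h
      simp only [a, Finset.mul_sum, MonoidAlgebra.single_mul_single, one_mul]
      exact Fintype.sum_equiv (Equiv.mulLeft h) _ _ (fun _ => rfl)
    have har : ∀ h : G, a * MonoidAlgebra.single h 1 = a := by
      intro h
      simp only [a, Finset.sum_mul, MonoidAlgebra.single_mul_single, one_mul]
      exact Fintype.sum_equiv (Equiv.mulRight h) _ _ (fun _ => rfl)
    have h1 := htr a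
    rw [ha1, ← Finset.sum_subset (Finset.subset_univ T)] at h1
    · have h2 : ∀ i ∈ T, (d i : ℂ) * (φ i a).trace = Fintype.card G := by
        intro i hi
        have h3 := (Finset.mem_filter.1 hi).2
        have h5 : φ i a = (Fintype.card G) • 1 := by simp [a, h3]
        rw [h5, Matrix.trace_smul, Matrix.trace_one, Fintype.card_fin, hdT i hi]
        simp
      rw [Finset.sum_congr rfl h2] at h1
      simp only [Finset.sum_const, nsmul_eq_mul] at h1
      have h4 : (T.card : ℂ) = 1 := by
        apply mul_right_cancel₀ hG0
        rw [← h1]; ring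
      exact_mod_cast h4
    · intro i _ hi
      obtain ⟨c, hc⟩ := central_scalar (φ i) (hφ i) a (fun h => by rw [hal, har])
      have hc0 : c = 0 := by
        by_contra hc0
        apply hi
        refine Finset.mem_filter.2 ⟨Finset.mem_univ _, fun h => ?_⟩
        have h3 := congrArg (φ i) (hal h)
        rw [map_mul, hc, ← Algebra.commutes, ← Algebra.smul_def, Algebra.algebraMap_eq_smul_one] at h3
        exact smul_right_injective _ hc0 h3
      rw [hc, hc0]; simp
  have h1 := htr (MonoidAlgebra.single g 1)
  have h0 : (MonoidAlgebra.single g 1 : MonoidAlgebra ℂ G).coeff 1 = 0 := by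
    simp [hg1, Finsupp.single_apply]
  rw [h0, mul_zero, ← Finset.sum_add_sum_compl T] at h1
  have h2 : ∑ i ∈ T, (d i : ℂ) * (φ i (MonoidAlgebra.single g 1)).trace = 1 := by
    have : ∀ i ∈ T, (d i : ℂ) * (φ i (MonoidAlgebra.single g 1)).trace = 1 := by
      intro i hi
      have h3 := (Finset.mem_filter.1 hi).2
      simp [h3, hdT i hi]
    rw [Finset.sum_congr rfl this]; simp [hTcard]
  rw [h2] at h1
  have h3 : ∀ i, ∃ y : ℂ, IsIntegral ℤ y ∧
      (i ∉ T → (d i : ℂ) * (φ i (MonoidAlgebra.single g 1)).trace = p * y) := by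
    intro i
    have hg : (φ i (MonoidAlgebra.single g 1)) ^ (Fintype.card G) = 1 := by
      rw [← map_pow, MonoidAlgebra.single_pow, pow_card_eq_one, one_pow, ← MonoidAlgebra.one_def,
        map_one]
    have hti := trace_isIntegral _ _ Fintype.card_pos hg
    rcases irr_cases hnc (φ i) (hφ i) g hg1 hp hcard with h | h | h
    · obtain ⟨m, hm⟩ := h
      refine ⟨m * (φ i (MonoidAlgebra.single g 1)).trace, ?_, fun _ => ?_⟩
      · have hmi : IsIntegral ℤ (m : ℂ) := by
          simpa using (isIntegral_algebraMap (R := ℤ) (A := ℂ) (x := (m : ℤ)))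
        exact hmi.mul hti
      · have hm' : (d i : ℂ) = p * m := by exact_mod_cast hm
        rw [hm']; ring
    · exact ⟨0, isIntegral_zero, fun _ => by rw [h]; simp⟩
    · exact ⟨0, isIntegral_zero, fun hi =>
        absurd (Finset.mem_filter.2 ⟨Finset.mem_univ _, h⟩) hi⟩
  choose y hy hy' using h3
  have h4 : ∑ i ∈ Tᶜ, (d i : ℂ) * (φ i (MonoidAlgebra.single g 1)).trace = p * ∑ i ∈ Tᶜ, y i := by
    rw [Finset.mul_sum]
    exact Finset.sum_congr rfl fun i hi => hy' i (Finset.mem_compl.1 hi)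
  rw [h4] at h1
  have h5 : IsIntegral ℤ (∑ i ∈ Tᶜ, y i) := IsIntegral.sum _ fun i _ => hy i
  have hp0 : (p : ℂ) ≠ 0 := by exact_mod_cast hp.ne_zero
  have h6 : (∑ i ∈ Tᶜ, y i) = algebraMap ℚ ℂ (-1 / p) := by
    have : (∑ i ∈ Tᶜ, y i) = -1 / p := by
      rw [eq_div_iff hp0]; linear_combination -h1
    rw [this]; simp
  rw [h6, isIntegral_algebraMap_iff (algebraMap ℚ ℂ).injective] at h5
  obtain ⟨z, hz⟩ := IsIntegrallyClosed.isIntegral_iff.1 h5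
  have hpq : (p : ℚ) ≠ 0 := by exact_mod_cast hp.ne_zero
  have h7 : (z : ℚ) * p = -1 := by
    have : (z : ℚ) = -1 / p := by simpa using hz
    rw [this]; field_simp
  have h8 : z * p = -1 := by exact_mod_cast h7
  have h9 : (p : ℤ) ∣ 1 := ⟨-z, by linarith⟩
  have := Int.natCast_dvd_natCast.1 (by simpa using h9 : (p : ℤ) ∣ ((1 : ℕ) : ℤ))
  exact hp.one_lt.ne' (Nat.dvd_one.1 this)

/-- Only the primes `p` and `q` divide the order of `G`. -/
def PQ (p q : ℕ) (G : Type) : Prop := ∀ r : ℕ, r.Prime → r ∣ Nat.card G → r = p ∨ r = q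

lemma simple_comm {p q : ℕ} (hp : p.Prime) (hq : q.Prime) {G : Type}
    [Group G] [Finite G] [IsSimpleGroup G] (hG : PQ p q G) : ∀ a b : G, a * b = b * a := by
  classical
  by_contra hnc
  have : Fintype G := Fintype.ofFinite G
  have hpf : Fact p.Prime := ⟨hp⟩
  have hqf : Fact q.Prime := ⟨hq⟩
  have center_bot : Subgroup.center G = ⊥ := by
    refine ((inferInstance : (Subgroup.center G).Normal).eq_bot_or_eq_top).resolve_right ?_
    intro h
    apply hnc
    intro a b
    have : b ∈ Subgroup.center G := by rw [h]; trivial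
    exact (Subgroup.mem_center_iff.1 this a)
  let Q : Sylow q G := default
  by_cases hQ : (Q : Subgroup G) = ⊥
  · -- then `G` is a `p`-group
    have hqn : ¬ q ∣ Nat.card G := by
      have := Q.not_dvd_index
      rwa [hQ, Subgroup.index_bot] at this
    have hGp : IsPGroup p G := by
      rw [IsPGroup.iff_card]
      refine ⟨_, Nat.eq_prime_pow_of_unique_prime_dvd Nat.card_pos.ne' ?_⟩
      intro d hd hdd
      rcases hG d hd hdd with h | h
      · exact h
      · subst h; exact absurd hdd hqn
    have := hGp.center_nontrivial
    rw [center_bot] at this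
    exact not_nontrivial _ this
  · have hQn : Nontrivial Q := (Subgroup.nontrivial_iff_ne_bot _).2 hQ
    have := Q.isPGroup'.center_nontrivial
    obtain ⟨⟨⟨g, hgQ⟩, hgc⟩, hg1⟩ := exists_ne (1 : Subgroup.center (Q : Subgroup G))
    have hg1' : g ≠ 1 := by
      intro h; apply hg1; apply Subtype.ext; apply Subtype.ext; exact h
    have hle : (Q : Subgroup G) ≤ Subgroup.centralizer {g} := by
      intro x hx
      rw [Subgroup.mem_centralizer_singleton_iff]
      have := Subgroup.mem_center_iff.1 hgc ⟨x, hx⟩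
      exact congrArg Subtype.val this
    have hcl : Nat.card (conjugatesOf g) = (Subgroup.centralizer {g}).index := by
      have h1 := MulAction.index_stabilizer (ConjAct G) g
      have h2 : MulAction.orbit (ConjAct G) g = conjugatesOf g := by
        ext x
        rw [ConjAct.mem_orbit_conjAct, isConj_comm]; rfl
      rw [h2] at h1
      rw [Nat.card_coe_set_eq, ← h1, Subgroup.index, Subgroup.index,
        Subgroup.centralizer_eq_comap_stabilizer]
      rfl
    have hd := Subgroup.index_dvd_of_le hle
    refine not_simple_of_class_card hnc g hg1' hp (k := (Nat.card (conjugatesOf g)).primeFactorsList.length) ?_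
    rw [hcl]
    refine Nat.eq_prime_pow_of_unique_prime_dvd (Subgroup.index_ne_zero_of_finite) ?_
    intro d hdp hdd
    rcases hG d hdp (hdd.trans (Subgroup.index_dvd_card _)) with h | h
    · exact h
    · subst h; exact absurd (hdd.trans hd) Q.not_dvd_index

lemma PQ.solvable {p q : ℕ} (hp : p.Prime) (hq : q.Prime) : ∀ (n : ℕ) (G : Type)
    [Group G] [Finite G] (_ : Nat.card G ≤ n) (_ : PQ p q G), Group.IsSolvable G := by
  intro n
  induction n with
  | zero =>
    intro G _ _ h _
    exact absurd h (by have := Nat.card_pos (α := G); omega)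
  | succ n ih =>
    intro G _ _ h hG
    by_cases hs : ∃ N : Subgroup G, N.Normal ∧ N ≠ ⊥ ∧ N ≠ ⊤
    · obtain ⟨N, hN, hb, ht⟩ := hs
      have hmul := Subgroup.card_mul_index N
      have h1 : Group.IsSolvable N := by
        refine ih N ?_ (fun r hr hd => hG r hr (hd.trans (Subgroup.card_subgroup_dvd_card N)))
        have h2 : N.index ≠ 1 := by rwa [Ne, Subgroup.index_eq_one]
        have h3 : 0 < N.index := Nat.pos_of_ne_zero Subgroup.index_ne_zero_of_finite
        have h4 : 0 < Nat.card N := Nat.card_pos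
        nlinarith [show 2 ≤ N.index by omega]
      have h2 : Group.IsSolvable (G ⧸ N) := by
        refine ih (G ⧸ N) ?_ (fun r hr hd => hG r hr (hd.trans (Subgroup.card_quotient_dvd_card N)))
        change N.index ≤ n
        have h2 : Nat.card N ≠ 1 := by rwa [Ne, Subgroup.card_eq_one]
        have h3 : 0 < N.index := Nat.pos_of_ne_zero Subgroup.index_ne_zero_of_finite
        have h4 : 0 < Nat.card N := Nat.card_pos
        nlinarith [show 2 ≤ Nat.card N by omega]
      exact Group.isSolvable_of_ker_le_range N.subtype (QuotientGroup.mk' N) (by simp)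
    · rcases subsingleton_or_nontrivial G with hsub | hnt
      · infer_instance
      · have : IsSimpleGroup G := ⟨fun N hN => by
          by_contra hc
          push Not at hc
          exact hs ⟨N, hN, hc.1, hc.2⟩⟩
        exact Group.isSolvable_of_comm (simple_comm hp hq hG)

/-- Restriction of automorphisms to a characteristic subgroup. -/
def resAut {G : Type} [Group G] (A : Subgroup G) [hA : A.Characteristic] :
    MulAut G →* MulAut A where
  toFun ϕ :=
    { toFun := fun x => ⟨ϕ (x : G), Subgroup.characteristic_iff_le_comap.1 hA ϕ x.2⟩
      invFun := fun x => ⟨ϕ.symm (x : G), Subgroup.characteristic_iff_le_comap.1 hA ϕ.symm x.2⟩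
      left_inv := fun x => Subtype.ext (ϕ.symm_apply_apply x)
      right_inv := fun x => Subtype.ext (ϕ.apply_symm_apply x)
      map_mul' := fun x y => Subtype.ext (map_mul ϕ (x : G) (y : G)) }
  map_one' := rfl
  map_mul' _ _ := rfl

/-- Action of automorphisms on the quotient by a characteristic subgroup. -/
def quotAut {G : Type} [Group G] (A : Subgroup G) [hA : A.Characteristic] :
    MulAut G →* MulAut (G ⧸ A) where
  toFun ϕ := QuotientGroup.congr A A ϕ (Subgroup.characteristic_iff_map_eq.1 hA ϕ)
  map_one' := by
    ext x
    induction x using QuotientGroup.induction_on with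
    | H x => rfl
  map_mul' _ _ := by
    ext x
    induction x using QuotientGroup.induction_on with
    | H x => rfl

lemma exists_char {p q : ℕ} (hp : p.Prime) (hq : q.Prime) {G : Type}
    [Group G] [Finite G] [Nontrivial G] (hG : PQ p q G) :
    ∃ N : Subgroup G, N.Characteristic ∧ N ≠ ⊥ ∧ (IsPGroup p N ∨ IsPGroup q N) := by
  classical
  have hsol := PQ.solvable hp hq _ G le_rfl hG
  have hex := hsol.solvable
  obtain ⟨m, hm⟩ : ∃ m, Nat.find hex = m + 1 := by
    refine Nat.exists_eq_succ_of_ne_zero ?_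
    intro h
    have := Nat.find_spec hex
    rw [h, derivedSeries_zero] at this
    exact top_ne_bot this
  have h1 := Nat.find_spec hex
  have h2 : derivedSeries G m ≠ ⊥ := Nat.find_min hex (by omega)
  rw [hm, derivedSeries_succ] at h1
  set A := derivedSeries G m with hA
  have hAc : A.Characteristic := derivedSeries_characteristic G m
  have hcomm : ∀ a b : A, a * b = b * a := by
    intro a b
    have := Subgroup.commutator_eq_bot_iff_le_centralizer.1 h1 a.2
    apply Subtype.ext
    exact (Subgroup.mem_centralizer_iff.1 this b b.2).symm
  have hnt : Nontrivial A := (Subgroup.nontrivial_iff_ne_bot _).2 h2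
  obtain ⟨r, hr, hrd⟩ := Nat.exists_prime_and_dvd (Finite.one_lt_card (α := A)).ne'
  have hrf : Fact r.Prime := ⟨hr⟩
  let R : Sylow r A := default
  have hRn : (R : Subgroup A).Normal := ⟨fun n hn g => by
    rw [hcomm g n, mul_assoc, mul_inv_cancel, mul_one]; exact hn⟩
  have hRc : (R : Subgroup A).Characteristic := R.characteristic_of_normal hRn
  refine ⟨(R : Subgroup A).map A.subtype, ?_, ?_, ?_⟩
  · rw [Subgroup.characteristic_iff_map_le]
    rintro ϕ _ ⟨_, ⟨x, hx, rfl⟩, rfl⟩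
    have h5 : (resAut A ϕ x) ∈ (R : Subgroup A) := by
      have := (Subgroup.characteristic_iff_map_le.1 hRc) (resAut A ϕ)
      exact this ⟨x, hx, rfl⟩
    exact ⟨resAut A ϕ x, h5, rfl⟩
  · intro h
    rw [Subgroup.map_eq_bot_iff_of_injective _ A.subtype_injective] at h
    exact R.ne_bot_of_dvd_card hrd h
  · have h3 := R.isPGroup'.map A.subtype
    rcases hG r hr (hrd.trans (Subgroup.card_subgroup_dvd_card A)) with h | h
    · subst h; exact Or.inl h3
    · subst h; exact Or.inr h3

lemma exists_normal_le {p q : ℕ} (hp : p.Prime) (hq : q.Prime) {G : Type}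
    [Group G] [Finite G] (hG : PQ p q G) (D : Subgroup G) [D.Normal] (hD : D ≠ ⊥) :
    ∃ N : Subgroup G, N.Normal ∧ N ≤ D ∧ N ≠ ⊥ ∧ (IsPGroup p N ∨ IsPGroup q N) := by
  have hnt : Nontrivial D := (Subgroup.nontrivial_iff_ne_bot _).2 hD
  obtain ⟨N, hN, hb, hpq⟩ := exists_char (G := D) hp hq
    (fun r hr hd => hG r hr (hd.trans (Subgroup.card_subgroup_dvd_card D)))
  refine ⟨N.map D.subtype, inferInstance, Subgroup.map_subtype_le N, ?_, ?_⟩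
  · rwa [Ne, Subgroup.map_eq_bot_iff_of_injective _ D.subtype_injective]
  · exact hpq.imp (fun h => h.map _) (fun h => h.map _)

lemma exists_core {p q : ℕ} (hp : p.Prime) (hq : q.Prime) {G : Type}
    [Group G] [Finite G] (hG : PQ p q G)
    (hO : ∀ N : Subgroup G, N.Normal → IsPGroup p N → N = ⊥) :
    ∃ Q : Subgroup G, Q.Normal ∧ IsPGroup q Q ∧ Subgroup.centralizer (Q : Set G) ≤ Q := by
  classical
  have hpf : Fact p.Prime := ⟨hp⟩
  have hqf : Fact q.Prime := ⟨hq⟩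
  obtain ⟨Q, hQ⟩ := (Set.toFinite {N : Subgroup G | N.Normal ∧ IsPGroup q N}).exists_maximal
    ⟨⊥, inferInstance, IsPGroup.of_bot⟩
  have hQn : Q.Normal := hQ.1.1
  have hQp : IsPGroup q Q := hQ.1.2
  have hmax : ∀ N : Subgroup G, N.Normal → IsPGroup q N → N ≤ Q := by
    intro N hN hNq
    have : N ⊔ Q ≤ Q := hQ.2 ⟨inferInstance, hNq.to_sup_of_normal_right hQp⟩ le_sup_right
    exact le_sup_left.trans this
  refine ⟨Q, hQn, hQp, ?_⟩
  by_contra hnot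
  set D := Subgroup.centralizer (Q : Set G) with hD
  have hDn : D.Normal := Subgroup.normal_centralizer
  let Z := D ⊓ Q
  have hZn : Z.Normal := inferInstance
  let π := QuotientGroup.mk' Z
  have hπs : Function.Surjective π := QuotientGroup.mk'_surjective Z
  have hDZ : (D.map π) ≠ ⊥ := by
    intro h
    rw [Subgroup.map_eq_bot_iff, QuotientGroup.ker_mk'] at h
    exact hnot (h.trans inf_le_right)
  have : (D.map π).Normal := hDn.map π hπs
  obtain ⟨N, hN, hND, hNb, hNpq⟩ := exists_normal_le (G := G ⧸ Z) hp hq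
    (fun r hr hd => hG r hr (hd.trans (Subgroup.card_quotient_dvd_card Z))) (D.map π) hDZ
  let M := N.comap π
  have hMn : M.Normal := hN.comap π
  have hMD : M ≤ D := by
    refine (Subgroup.comap_mono hND).trans ?_
    rw [Subgroup.comap_map_eq, QuotientGroup.ker_mk']
    exact sup_le le_rfl inf_le_left
  rcases hNpq with hNp | hNq
  · -- `M` is nilpotent
    have hmem : ∀ x : M, π x ∈ N := fun x => x.2
    let f : M →* N := (π.comp M.subtype).codRestrict N hmem
    have hfs : Function.Surjective f := by
      rintro ⟨y, hy⟩
      obtain ⟨x, rfl⟩ := hπs y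
      exact ⟨⟨x, hy⟩, rfl⟩
    have hker : f.ker ≤ Subgroup.center M := by
      intro x hx
      have h1 : π x = 1 := congrArg Subtype.val (MonoidHom.mem_ker.1 hx)
      have h2 : (x : G) ∈ Z := (QuotientGroup.eq_one_iff _).1 h1
      rw [Subgroup.mem_center_iff]
      intro y
      apply Subtype.ext
      have h3 : (y : G) ∈ D := hMD y.2
      exact ((Subgroup.mem_centralizer_iff.1 h3 x h2.2).symm)
    have hNnil : Group.IsNilpotent N := hNp.isNilpotent
    have hMnil : Group.IsNilpotent M := Subgroup.isNilpotent_of_ker_le_center f hker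
    have hNnt : Nontrivial N := (Subgroup.nontrivial_iff_ne_bot _).2 hNb
    have hpd : p ∣ Nat.card M := by
      have h1 : p ∣ Nat.card N := by
        obtain ⟨n, hn, hc⟩ := hNp.nontrivial_iff_card.1 hNnt
        rw [hc]; exact dvd_pow_self _ hn.ne'
      exact h1.trans (Subgroup.card_dvd_of_surjective f hfs)
    let P : Sylow p M := default
    have hPc : (P : Subgroup M).Characteristic := P.characteristic_of_normal inferInstance
    have := hO ((P : Subgroup M).map M.subtype) inferInstance (P.isPGroup'.map _)
    rw [Subgroup.map_eq_bot_iff_of_injective _ M.subtype_injective] at this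
    exact P.ne_bot_of_dvd_card hpd this
  · have hMq : IsPGroup q M := by
      refine hNq.comap_of_ker_isPGroup π ?_
      rw [QuotientGroup.ker_mk']
      exact hQp.to_le inf_le_right
    have hMQ := hmax M hMn hMq
    have hMZ : M ≤ Z := le_inf hMD hMQ
    apply hNb
    rw [eq_bot_iff]
    intro y hy
    obtain ⟨x, rfl⟩ := hπs y
    exact (QuotientGroup.eq_one_iff _).2 (hMZ hy)

lemma gam_zero (q : ℕ) : gam 0 q = 1 := by simp [gam]

lemma gam_succ (t q : ℕ) : gam (t + 1) q = gam t q * (q ^ (t + 1) - 1) := by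
  simp [gam, Finset.prod_range_succ]

lemma gam_mul_dvd (q : ℕ) (hq : 0 < q) : ∀ n a b : ℕ, a + b = n → gam a q * gam b q ∣ gam n q := by
  intro n
  induction n with
  | zero =>
    intro a b h
    obtain ⟨rfl, rfl⟩ : a = 0 ∧ b = 0 := by omega
    simp [gam_zero]
  | succ n ih =>
    intro a b h
    rcases Nat.eq_zero_or_pos a with rfl | ha
    · obtain rfl : b = n + 1 := by omega
      simp [gam_zero]
    rcases Nat.eq_zero_or_pos b with rfl | hb
    · obtain rfl : a = n + 1 := by omega
      simp [gam_zero]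
    obtain ⟨a, rfl⟩ := Nat.exists_eq_succ_of_ne_zero ha.ne'
    obtain ⟨b, rfl⟩ := Nat.exists_eq_succ_of_ne_zero hb.ne'
    have h1 := ih a (b + 1) (by omega)
    have h2 := ih (a + 1) b (by omega)
    have key : q ^ (n + 1) - 1 = (q ^ (a + 1) - 1) + q ^ (a + 1) * (q ^ (b + 1) - 1) := by
      have h3 : n + 1 = (a + 1) + (b + 1) := by omega
      have h4 : 1 ≤ q ^ (a + 1) := Nat.one_le_pow _ _ hq
      have h5 : 1 ≤ q ^ (b + 1) := Nat.one_le_pow _ _ hq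
      have h6 : q ^ (a + 1) ≤ q ^ (a + 1) * q ^ (b + 1) := Nat.le_mul_of_pos_right _ h5
      rw [h3, pow_add, Nat.mul_sub, mul_one]
      omega
    rw [gam_succ n, key, mul_add]
    apply dvd_add
    · rw [Nat.succ_eq_add_one, gam_succ a]
      convert mul_dvd_mul h1 (dvd_refl (q ^ (a + 1) - 1)) using 1
      ring
    · rw [Nat.succ_eq_add_one b, gam_succ b]
      have h7 := mul_dvd_mul h2 (dvd_mul_left (q ^ (b + 1) - 1) (q ^ (a + 1)))
      rwa [mul_assoc] at h7

lemma gam_dvd {q a b : ℕ} (hq : 0 < q) (h : a ≤ b) : gam a q ∣ gam b q :=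
  (Dvd.intro _ rfl).trans (gam_mul_dvd q hq b a (b - a) (by omega))

lemma gl_prod (u q : ℕ) :
    ∏ i : Fin u, (q ^ u - q ^ (i : ℕ)) = (∏ i ∈ Finset.range u, q ^ i) * gam u q := by
  rw [Fin.prod_univ_eq_prod_range (fun i => q ^ u - q ^ i) u, gam,
    ← Finset.prod_range_reflect (fun i => q ^ (i + 1) - 1), ← Finset.prod_mul_distrib]
  refine Finset.prod_congr rfl fun i hi => ?_
  have := Finset.mem_range.1 hi
  rw [Nat.mul_sub, ← pow_add, mul_one]
  congr 2
  omega

lemma card_GL_eq (u q : ℕ) [hq : Fact q.Prime] :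
    Nat.card (GL (Fin u) (ZMod q)) = (∏ i ∈ Finset.range u, q ^ i) * gam u q := by
  rw [Matrix.card_GL_field, ZMod.card, gl_prod]

lemma elem_abelian {p q u : ℕ} (hp : p.Prime) (hq : q.Prime) (hpq : p ≠ q) (Q : Type) [CommGroup Q]
    [Finite Q] (hQ : Nat.card Q = q ^ u) (hexp : ∀ x : Q, x ^ q = 1)
    (P : Subgroup (MulAut Q)) (hP : IsPGroup p P) : Nat.card P ∣ gam u q := by
  classical
  have hpf : Fact p.Prime := ⟨hp⟩
  have hqf : Fact q.Prime := ⟨hq⟩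
  letI : Module (ZMod q) (Additive Q) := AddCommGroup.zmodModule (n := q) (fun x => hexp x.toMul)
  have hfr : Module.finrank (ZMod q) (Additive Q) = u := by
    have h1 := Module.natCard_eq_pow_finrank (K := ZMod q) (V := Additive Q)
    rw [Nat.card_zmod] at h1
    have h2 : Nat.card (Additive Q) = q ^ u := hQ
    rw [h2] at h1
    exact (Nat.pow_right_injective hq.two_le h1).symm
  let b := Module.finBasisOfFinrankEq (ZMod q) (Additive Q) hfr
  let f : MulAut Q →* Module.End (ZMod q) (Additive Q) :=
    { toFun := fun ϕ => (MonoidHom.toAdditive ϕ.toMonoidHom).toZModLinearMap q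
      map_one' := by ext x; rfl
      map_mul' := fun _ _ => by ext x; rfl }
  have hf : Function.Injective f := by
    intro ϕ ψ h
    ext x
    exact congrArg (fun F : Module.End (ZMod q) (Additive Q) => (F (Additive.ofMul x)).toMul) h
  let F : MulAut Q →* GL (Fin u) (ZMod q) :=
    (((LinearMap.toMatrixAlgEquiv b : _ →* _)).comp f).toHomUnits
  have hF : Function.Injective F := by
    intro ϕ ψ h
    apply hf
    apply (LinearMap.toMatrixAlgEquiv b).injective
    exact congrArg Units.val h
  have hd : Nat.card P ∣ Nat.card (GL (Fin u) (ZMod q)) :=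
    Subgroup.card_dvd_of_injective (F.comp P.subtype) (hF.comp P.subtype_injective)
  rw [card_GL_eq] at hd
  obtain ⟨k, hk⟩ := IsPGroup.iff_card.1 hP
  rw [hk] at hd ⊢
  refine Nat.Coprime.dvd_of_dvd_mul_left ?_ hd
  apply Nat.Coprime.pow_left
  apply Nat.Coprime.prod_right
  intro i _
  exact Nat.Coprime.pow_right _ ((Nat.coprime_primes hp hq).2 hpq)

lemma stab_trivial {p q : ℕ} (hp : p.Prime) (hq : q.Prime) (hpq : p ≠ q) (Q : Type) [Group Q]
    (hQ : IsPGroup q Q) (N : Subgroup Q) [N.Characteristic]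
    (ϕ : MulAut Q) (k : ℕ) (hϕ : ϕ ^ (p ^ k) = 1) (h1 : resAut N ϕ = 1) (h2 : quotAut N ϕ = 1) :
    ϕ = 1 := by
  ext x
  have hn : x⁻¹ * ϕ x ∈ N := by
    rw [← QuotientGroup.eq]
    have := DFunLike.congr_fun h2 (x : Q ⧸ N)
    exact this.symm
  have hfix : ∀ y ∈ N, ϕ y = y := fun y hy => by
    have := DFunLike.congr_fun h1 ⟨y, hy⟩
    exact congrArg Subtype.val this
  set n := x⁻¹ * ϕ x with hnn
  have hx : ϕ x = x * n := by simp [hnn]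
  have hpow : ∀ j : ℕ, (ϕ ^ j) x = x * n ^ j := by
    intro j
    induction j with
    | zero => simp
    | succ j ih =>
      rw [pow_succ', MulAut.mul_apply, ih, map_mul, hx, hfix _ (N.pow_mem hn j), pow_succ', mul_assoc]
  have h3 := hpow (p ^ k)
  rw [hϕ] at h3
  have h4 : n ^ (p ^ k) = 1 := by simpa using h3
  obtain ⟨m, hm⟩ := hQ n
  have h5 : n = 1 := by
    rw [← orderOf_eq_one_iff, ← Nat.dvd_one]
    have hc : Nat.Coprime (p ^ k) (q ^ m) := Nat.Coprime.pow _ _ ((Nat.coprime_primes hp hq).2 hpq)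
    rw [← hc]
    exact Nat.dvd_gcd (orderOf_dvd_of_pow_eq_one h4) (orderOf_dvd_of_pow_eq_one hm)
  rw [hx, h5]; simp

lemma coprime_action {p q : ℕ} (hp : p.Prime) (hq : q.Prime) (hpq : p ≠ q) :
    ∀ (m u : ℕ) (_ : u ≤ m) (Q : Type) [Group Q] [Finite Q] (_ : Nat.card Q = q ^ u)
      (P : Subgroup (MulAut Q)) (_ : IsPGroup p P), Nat.card P ∣ gam u q := by
  have hpf : Fact p.Prime := ⟨hp⟩
  have hqf : Fact q.Prime := ⟨hq⟩
  intro m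
  induction m with
  | zero =>
    intro u hu Q _ _ hQ P hP
    obtain rfl : u = 0 := by omega
    rw [pow_zero] at hQ
    have : Subsingleton Q := (Nat.card_eq_one_iff_unique.1 hQ).1
    have : Subsingleton (MulAut Q) := ⟨fun a b => by ext x; exact Subsingleton.elim _ _⟩
    simp
  | succ m ih =>
    intro u hu Q _ _ hQ P hP
    have hQq : IsPGroup q Q := IsPGroup.of_card hQ
    -- the inductive step for a proper non-trivial characteristic subgroup
    have step : ∀ N : Subgroup Q, N.Characteristic → N ≠ ⊥ → N ≠ ⊤ → Nat.card P ∣ gam u q := by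
      intro N hN hb ht
      obtain ⟨a, ha⟩ := IsPGroup.iff_card.1 (hQq.to_subgroup N)
      obtain ⟨b, hb'⟩ := IsPGroup.iff_card.1 (hQq.to_quotient N)
      have hab : a + b = u := by
        have := Subgroup.card_eq_card_quotient_mul_card_subgroup N
        rw [hQ, ha, hb', ← pow_add] at this
        have := Nat.pow_right_injective hq.two_le this
        omega
      have ha0 : a ≠ 0 := by
        rintro rfl
        rw [pow_zero, Subgroup.card_eq_one] at ha
        exact hb ha
      have hb0 : b ≠ 0 := by
        rintro rfl
        rw [pow_zero] at hb'
        exact ht (Subgroup.index_eq_one.1 hb')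
      have h1 := ih a (by omega) N ha (P.map (resAut N)) (hP.map _)
      have h2 := ih b (by omega) (Q ⧸ N) hb' (P.map (quotAut N)) (hP.map _)
      refine dvd_trans ?_ ((mul_dvd_mul h1 h2).trans (gam_mul_dvd q hq.pos u a b hab))
      rw [← Nat.card_prod]
      let F : P →* (P.map (resAut N)) × (P.map (quotAut N)) :=
        ((resAut N).subgroupMap P).prod ((quotAut N).subgroupMap P)
      refine Subgroup.card_dvd_of_injective F ?_
      rw [injective_iff_map_eq_one]
      rintro x hx
      obtain ⟨k, hk⟩ := hP x
      apply Subtype.ext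
      refine stab_trivial hp hq hpq Q hQq N x k (congrArg Subtype.val hk) ?_ ?_
      · exact congrArg (fun y => (y.1 : MulAut N)) hx
      · exact congrArg (fun y => (y.2 : MulAut (Q ⧸ N))) hx
    rcases subsingleton_or_nontrivial Q with hs | hnt
    · have : Subsingleton (MulAut Q) := ⟨fun a b => by ext x; exact Subsingleton.elim _ _⟩
      simp
    by_cases hc : Subgroup.center Q = ⊤
    · have hcomm : ∀ a b : Q, a * b = b * a := fun a b => by
        have : b ∈ Subgroup.center Q := by rw [hc]; trivial
        exact (Subgroup.mem_center_iff.1 this a)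
      letI : CommGroup Q := { ‹Group Q› with mul_comm := hcomm }
      let N : Subgroup Q := (powMonoidHom q : Q →* Q).range
      have hNc : N.Characteristic := by
        rw [Subgroup.characteristic_iff_map_le]
        rintro ϕ _ ⟨_, ⟨x, rfl⟩, rfl⟩
        exact ⟨ϕ x, by simp⟩
      have hNt : N ≠ ⊤ := by
        intro h
        have hsurj : Function.Surjective (powMonoidHom q : Q →* Q) := MonoidHom.range_eq_top.1 h
        have hinj := Finite.injective_iff_surjective.2 hsurj
        have hqd : q ∣ Nat.card Q := by
          obtain ⟨n, hn, hcd⟩ := hQq.nontrivial_iff_card.1 hnt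
          rw [hcd]; exact dvd_pow_self _ hn.ne'
        obtain ⟨x, hx⟩ := exists_prime_orderOf_dvd_card' q hqd
        have : x = 1 := hinj (by simp [← hx, pow_orderOf_eq_one])
        rw [this, orderOf_one] at hx
        exact hq.one_lt.ne hx
      by_cases hNb : N = ⊥
      · refine elem_abelian hp hq hpq Q hQ ?_ P hP
        intro x
        have : (powMonoidHom q : Q →* Q) x ∈ N := ⟨x, rfl⟩
        rw [hNb, Subgroup.mem_bot] at this
        exact this
      · exact step N hNc hNb hNt
    · refine step (Subgroup.center Q) inferInstance ?_ hc
      have := hQq.center_nontrivial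
      exact (Subgroup.nontrivial_iff_ne_bot _).1 this

lemma Gam_prime_pow {q t : ℕ} (hq : q.Prime) : Gam (q ^ t) = gam t q := by
  rw [Gam, hq.factorization_pow, Finsupp.prod_single_index (gam_zero q)]

lemma dir_core {p q s t : ℕ} (hp : p.Prime) (hq : q.Prime) (hpq : p ≠ q) (G : Type) [Group G]
    [Finite G] (hG : Nat.card G = p ^ s * q ^ t)
    (hO : ∀ N : Subgroup G, N.Normal → IsPGroup p N → N = ⊥) : p ^ s ∣ gam t q := by
  have hpf : Fact p.Prime := ⟨hp⟩
  have hqf : Fact q.Prime := ⟨hq⟩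
  have hPQ : PQ p q G := by
    intro r hr hd
    rw [hG] at hd
    rcases hr.dvd_mul.1 hd with h | h
    · exact Or.inl ((Nat.prime_dvd_prime_iff_eq hr hp).1 (hr.dvd_of_dvd_pow h))
    · exact Or.inr ((Nat.prime_dvd_prime_iff_eq hr hq).1 (hr.dvd_of_dvd_pow h))
  obtain ⟨Q, hQn, hQ, hC⟩ := exists_core hp hq hPQ hO
  obtain ⟨u, hu⟩ := IsPGroup.iff_card.1 hQ
  have hut : u ≤ t := by
    have h1 : q ^ u ∣ p ^ s * q ^ t := by rw [← hu, ← hG]; exact Subgroup.card_subgroup_dvd_card Q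
    have h2 : Nat.Coprime (q ^ u) (p ^ s) :=
      Nat.Coprime.pow _ _ ((Nat.coprime_primes hq hp).2 hpq.symm)
    exact (Nat.pow_dvd_pow_iff_le_right hq.one_lt).1 (h2.dvd_of_dvd_mul_left h1)
  obtain ⟨P, hPc⟩ := Sylow.exists_subgroup_card_pow_prime (G := G) p (n := s)
    (by rw [hG]; exact dvd_mul_right _ _)
  have hP : IsPGroup p P := IsPGroup.of_card hPc
  let F : P →* MulAut Q := (MulAut.conjNormal (H := Q)).comp P.subtype
  have hF : Function.Injective F := by
    rw [injective_iff_map_eq_one]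
    intro x hx
    have hxQ : (x : G) ∈ Q := by
      apply hC
      rw [Subgroup.mem_centralizer_iff]
      intro y hy
      have h1 := congrArg Subtype.val (DFunLike.congr_fun hx ⟨y, hy⟩)
      have h2 : (x : G) * y * (x : G)⁻¹ = y := h1
      rw [mul_inv_eq_iff_eq_mul] at h2
      exact h2.symm
    have hdis := IsPGroup.disjoint_of_ne p q hpq P Q hP hQ
    have h3 := hdis.le_bot (show (x : G) ∈ P ⊓ Q from ⟨x.2, hxQ⟩)
    exact Subtype.ext (Subgroup.mem_bot.1 h3)
  have hcard : Nat.card F.range = p ^ s := by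
    rw [← hPc]
    exact (Nat.card_congr (MonoidHom.ofInjective hF).toEquiv).symm
  have h := coprime_action hp hq hpq u u le_rfl Q hu F.range (IsPGroup.of_card hcard)
  rw [hcard] at h
  exact h.trans (gam_dvd hq.pos hut)

lemma semi_core {p q : ℕ} [Fact p.Prime] [Fact q.Prime] (hpq : p ≠ q) (V P : Type) [CommGroup V]
    [Group P] (φ : P →* MulAut V) (hφ : ∀ g, (∀ v, φ g v = v) → g = 1) (hVq : IsPGroup q V) :
    ∀ N : Subgroup (V ⋊[φ] P), N.Normal → IsPGroup p N → N = ⊥ := by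
  intro N hN hNp
  have hz : ∀ v : V, (SemidirectProduct.inl v : V ⋊[φ] P) ∈ N → v = 1 := by
    intro v hv
    have hdis := IsPGroup.disjoint_of_ne p q hpq N
      ((SemidirectProduct.inl : V →* V ⋊[φ] P).range) hNp
      (hVq.of_surjective (SemidirectProduct.inl : V →* V ⋊[φ] P).rangeRestrict
        (MonoidHom.rangeRestrict_surjective _))
    have h3 := hdis.le_bot (show _ ∈ N ⊓ _ from ⟨hv, ⟨v, rfl⟩⟩)
    apply SemidirectProduct.inl_injective (φ := φ)
    rw [map_one]
    exact Subgroup.mem_bot.1 h3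
  rw [Subgroup.eq_bot_iff_forall]
  intro x hx
  have hr : x.right = 1 := by
    apply hφ
    intro v
    have h1 : x * (SemidirectProduct.inl v * x⁻¹ * (SemidirectProduct.inl v)⁻¹) ∈ N :=
      N.mul_mem hx (hN.conj_mem _ (N.inv_mem hx) _)
    have h2 : x * (SemidirectProduct.inl v * x⁻¹ * (SemidirectProduct.inl v)⁻¹) =
        SemidirectProduct.inl (φ x.right v * v⁻¹) := by
      apply SemidirectProduct.ext
      · simp only [SemidirectProduct.mul_left, SemidirectProduct.mul_right, SemidirectProduct.inv_left,
          SemidirectProduct.inv_right, SemidirectProduct.left_inl, SemidirectProduct.right_inl, map_mul,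
          ← MulAut.mul_apply, ← map_mul, mul_inv_cancel, one_mul, map_one, MulAut.one_apply, map_inv]
        simp [mul_comm, mul_left_comm]
        rw [mul_assoc, mul_left_comm, mul_inv_cancel_left]
      · simp
    rw [h2] at h1
    exact mul_inv_eq_one.1 (hz _ h1)
  have hl : x = SemidirectProduct.inl x.left := by
    apply SemidirectProduct.ext
    · simp
    · simp [hr]
  rw [hl] at hx ⊢
  rw [hz _ hx, map_one]

lemma dir_example {p q s t : ℕ} (hp : p.Prime) (hq : q.Prime) (hpq : p ≠ q)
    (hd : p ^ s ∣ gam t q) :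
    ∃ (G : Type) (_ : Group G) (_ : Finite G), Nat.card G = p ^ s * q ^ t ∧
      ∀ N : Subgroup G, N.Normal → IsPGroup p N → N = ⊥ := by
  have hpf : Fact p.Prime := ⟨hp⟩
  have hqf : Fact q.Prime := ⟨hq⟩
  obtain ⟨P, hPc⟩ := Sylow.exists_subgroup_card_pow_prime (G := GL (Fin t) (ZMod q)) p (n := s)
    (by rw [card_GL_eq]; exact hd.mul_left _)
  let V := Multiplicative (Fin t → ZMod q)
  let φ₀ : GL (Fin t) (ZMod q) →* MulAut V :=
    { toFun := fun g =>
        { toFun := fun v => Multiplicative.ofAdd ((g : Matrix (Fin t) (Fin t) (ZMod q)).mulVec v.toAdd)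
          invFun := fun v => Multiplicative.ofAdd
            (((g⁻¹ : GL (Fin t) (ZMod q)) : Matrix (Fin t) (Fin t) (ZMod q)).mulVec v.toAdd)
          left_inv := fun v => by
            apply Multiplicative.toAdd.injective
            simp only [toAdd_ofAdd, Matrix.mulVec_mulVec, ← Units.val_mul, inv_mul_cancel]
            simp
          right_inv := fun v => by
            apply Multiplicative.toAdd.injective
            simp only [toAdd_ofAdd, Matrix.mulVec_mulVec, ← Units.val_mul, mul_inv_cancel]
            simp
          map_mul' := fun v w => by
            apply Multiplicative.toAdd.injective
            exact Matrix.mulVec_add (g : Matrix (Fin t) (Fin t) (ZMod q)) v.toAdd w.toAdd }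
      map_one' := by
        ext v : 1
        apply Multiplicative.toAdd.injective
        simp
      map_mul' := fun g h => by
        ext v : 1
        apply Multiplicative.toAdd.injective
        simp [Matrix.mulVec_mulVec] }
  have hφ₀ : ∀ g, (∀ v, φ₀ g v = v) → g = 1 := by
    intro g hg
    apply Units.ext
    apply Matrix.mulVec_injective
    funext v
    have := congrArg Multiplicative.toAdd (hg (Multiplicative.ofAdd v))
    rw [Units.val_one, Matrix.one_mulVec]
    exact this
  let φ : P →* MulAut V := φ₀.comp P.subtype
  have hφ : ∀ g, (∀ v, φ g v = v) → g = 1 := fun g hg => Subtype.ext (hφ₀ g hg)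
  have hV : Nat.card V = q ^ t := by
    have : Nat.card V = Nat.card (Fin t → ZMod q) := rfl
    rw [this]; simp
  have hVf : Finite V := inferInstanceAs (Finite (Fin t → ZMod q))
  have hVq : IsPGroup q V := IsPGroup.of_card hV
  refine ⟨V ⋊[φ] P, inferInstance, Finite.of_equiv _ SemidirectProduct.equivProd.symm, ?_, ?_⟩
  · rw [SemidirectProduct.card, hV, hPc, mul_comm]
  · exact semi_core hpq V P φ hφ hVq

/-- Let `n = p^s·q^t` with `p ≠ q` primes and `s, t > 0`.  Every finite group of
order `n` has a nontrivial normal `p`-subgroup if and only if `p^s ∤ Γ(q^t)`. -/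
theorem forall_nontrivial_normal_pSubgroup_iff_of_prime_pow (p q s t : ℕ)
    (hp : p.Prime) (hq : q.Prime) (hpq : p ≠ q) (hs : 0 < s) (ht : 0 < t) :
    (∀ (G : Type) (_ : Group G) (_ : Finite G), Nat.card G = p ^ s * q ^ t →
      ∃ N : Subgroup G, N.Normal ∧ IsPGroup p N ∧ N ≠ ⊥) ↔
    ¬ p ^ s ∣ Gam (q ^ t) := by
  rw [Gam_prime_pow hq]
  constructor
  · intro h hd
    obtain ⟨G, i1, i2, hc, hN⟩ := dir_example (s := s) (t := t) hp hq hpq hd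
    obtain ⟨N, h1, h2, h3⟩ := h G i1 i2 hc
    exact h3 (hN N h1 h2)
  · intro h G i1 i2 hG
    by_contra! hcon
    exact h (dir_core hp hq hpq G hG hcon)
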